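/- Theorem 4.1(i), first case: Suppose the symmetric, measurable, uniformly elliptic coefficients a^{ij} on ℝ^{d+1} are independent of x', i.e. a^{ij}(t,x',x'') = a^{ij}(t,y',x'') for all t, x', y', x''. Let δ ∈ (0,1), let f satisfy [f]_{x',δ;ℝ^{d+1}_0} < ∞, and let u be a bounded classical solution of u_t − a^{ij}D_{ij}u = f in ℝ^{d+1}_0 := (−∞,0)×ℝ^d. Then there is a constant N depending only on d, q, δ, ν such that [u]_{x',2+δ;ℝ^{d+1}_0} ≤ N [f]_{x',δ;ℝ^{d+1}_0}, i.e. [D_i D_j u]_{x',δ;ℝ^{d+1}_0} ≤ N [f]_{x',δ;ℝ^{d+1}_0} for all 1 ≤ i,j ≤ q. -/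

import Mathlib

open MeasureTheory Metric Set Filter

noncomputable section

/-- Spatial first-order partial derivative `D_i`. -/
def sd {d : ℕ} (i : Fin d) (v : EuclideanSpace ℝ (Fin d) → ℝ)
    (x : EuclideanSpace ℝ (Fin d)) : ℝ :=
  fderiv ℝ v x (EuclideanSpace.single i 1)

/-- Spatial second-order partial derivative `D_i D_j`. -/
def sd2 {d : ℕ} (i j : Fin d) (v : EuclideanSpace ℝ (Fin d) → ℝ)
    (x : EuclideanSpace ℝ (Fin d)) : ℝ :=
  sd i (fun y => sd j v y) x

/-- Time derivative `∂_t`. -/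
def td {d : ℕ} (u : ℝ → EuclideanSpace ℝ (Fin d) → ℝ) (t : ℝ)
    (x : EuclideanSpace ℝ (Fin d)) : ℝ :=
  deriv (fun s => u s x) t

/-- Parabolic cylinder `Q_ρ = (-ρ², 0) × B_ρ`. -/
def parQ (d : ℕ) (ρ : ℝ) : Set (ℝ × EuclideanSpace ℝ (Fin d)) :=
  Ioo (-(ρ ^ 2)) 0 ×ˢ ball (0 : EuclideanSpace ℝ (Fin d)) ρ

/-- The half space `ℝ^{d+1}_0 = (-∞, 0) × ℝ^d`. -/
def parNeg (d : ℕ) : Set (ℝ × EuclideanSpace ℝ (Fin d)) :=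
  Iio (0 : ℝ) ×ˢ (univ : Set (EuclideanSpace ℝ (Fin d)))

/-- Partial Hölder bound in the first `q` spatial coordinates `x'`. -/
def PHolderXPar (d q : ℕ) (δ : ℝ) (Q : Set (ℝ × EuclideanSpace ℝ (Fin d)))
    (g : ℝ → EuclideanSpace ℝ (Fin d) → ℝ) (K : ℝ) : Prop :=
  ∀ (t : ℝ) (x y : EuclideanSpace ℝ (Fin d)), (t, x) ∈ Q → (t, y) ∈ Q →
    (∀ i : Fin d, q ≤ (i : ℕ) → x i = y i) → |g t x - g t y| ≤ K * dist x y ^ δ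

/-- Full spatial Hölder bound. -/
def HolderXPar (d : ℕ) (δ : ℝ) (Q : Set (ℝ × EuclideanSpace ℝ (Fin d)))
    (g : ℝ → EuclideanSpace ℝ (Fin d) → ℝ) (K : ℝ) : Prop :=
  ∀ (t : ℝ) (x y : EuclideanSpace ℝ (Fin d)), (t, x) ∈ Q → (t, y) ∈ Q →
    |g t x - g t y| ≤ K * dist x y ^ δ

/-- Hölder bound in the time variable `t`, with exponent `γ`. -/
def HolderTPar (d : ℕ) (γ : ℝ) (Q : Set (ℝ × EuclideanSpace ℝ (Fin d)))
    (g : ℝ → EuclideanSpace ℝ (Fin d) → ℝ) (K : ℝ) : Prop :=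
  ∀ (t s : ℝ) (x : EuclideanSpace ℝ (Fin d)), (t, x) ∈ Q → (s, x) ∈ Q →
    |g t x - g s x| ≤ K * |t - s| ^ γ

/-- Classical regularity of parabolic solutions: `u`, `∂_t u`, `Du`, `D²u` exist and are
continuous on `Q`. -/
def ParClassical {d : ℕ} (Q : Set (ℝ × EuclideanSpace ℝ (Fin d)))
    (u : ℝ → EuclideanSpace ℝ (Fin d) → ℝ) : Prop :=
  (∀ z ∈ Q, DifferentiableAt ℝ (fun s => u s z.2) z.1) ∧
  (∀ z ∈ Q, ContDiffAt ℝ 2 (u z.1) z.2) ∧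
  ContinuousOn (fun z : ℝ × EuclideanSpace ℝ (Fin d) => u z.1 z.2) Q ∧
  ContinuousOn (fun z : ℝ × EuclideanSpace ℝ (Fin d) => td u z.1 z.2) Q ∧
  (∀ i : Fin d,
    ContinuousOn (fun z : ℝ × EuclideanSpace ℝ (Fin d) => sd i (u z.1) z.2) Q) ∧
  (∀ i j : Fin d,
    ContinuousOn (fun z : ℝ × EuclideanSpace ℝ (Fin d) => sd2 i j (u z.1) z.2) Q)

/-- Uniform ellipticity with constant `ν` (parabolic, two-sided bound). -/
def UnifEllipticP (d : ℕ) (ν : ℝ)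
    (a : Fin d → Fin d → ℝ → EuclideanSpace ℝ (Fin d) → ℝ) : Prop :=
  ∀ (t : ℝ) (x : EuclideanSpace ℝ (Fin d)) (ξ : Fin d → ℝ),
    ν * ∑ i, ξ i ^ 2 ≤ ∑ i, ∑ j, a i j t x * ξ i * ξ j ∧
      ∑ i, ∑ j, a i j t x * ξ i * ξ j ≤ ν⁻¹ * ∑ i, ξ i ^ 2

/-- Necessary second-order condition at a local maximum. -/
lemma second_deriv_nonpos {g g1 : ℝ → ℝ} {c : ℝ} (h1 : ∀ r, HasDerivAt g (g1 r) r)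
    (h2 : HasDerivAt g1 c 0) (hm : IsLocalMax g 0) : c ≤ 0 := by
  by_contra hc
  push Not at hc
  have hd : deriv g = g1 := funext fun r => (h1 r).deriv
  have h0 : deriv g 0 = 0 := hm.deriv_eq_zero
  have hdd : deriv (deriv g) 0 = c := by rw [hd]; exact h2.deriv
  have hmin : IsLocalMin g 0 :=
    isLocalMin_of_deriv_deriv_pos (by rw [hdd]; exact hc) h0 (h1 0).continuousAt
  have hE : g =ᶠ[nhds 0] fun _ => g 0 := by
    filter_upwards [hm, hmin] with r hr1 hr2
    exact le_antisymm hr1 hr2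
  have h3 : deriv g =ᶠ[nhds 0] deriv (fun _ => g 0) := hE.deriv
  have h4 := h3.deriv_eq
  rw [hdd] at h4
  simp at h4
  linarith

lemma sd2_eq {d : ℕ} {φ : EuclideanSpace ℝ (Fin d) → ℝ} (hφ : ContDiff ℝ 2 φ) (i j : Fin d)
    (x : EuclideanSpace ℝ (Fin d)) :
    sd2 i j φ x = fderiv ℝ (fderiv ℝ φ) x (EuclideanSpace.single i 1)
      (EuclideanSpace.single j 1) := by
  have h1 : ContDiff ℝ 1 (fderiv ℝ φ) := hφ.fderiv_right (by norm_num)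
  have h2 : DifferentiableAt ℝ (fderiv ℝ φ) x := (h1.differentiable (by norm_num)) x
  unfold sd2 sd
  rw [fderiv_clm_apply h2 (differentiableAt_const _)]
  simp

lemma line_deriv {d : ℕ} {φ : EuclideanSpace ℝ (Fin d) → ℝ} (hφ : ContDiff ℝ 2 φ)
    (x ξ : EuclideanSpace ℝ (Fin d)) (r : ℝ) :
    HasDerivAt (fun r : ℝ => φ (x + r • ξ)) (fderiv ℝ φ (x + r • ξ) ξ) r := by
  have h1 : HasFDerivAt φ (fderiv ℝ φ (x + r • ξ)) (x + r • ξ) :=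
    ((hφ.differentiable (by norm_num)) _).hasFDerivAt
  have h2 : HasDerivAt (fun r : ℝ => x + r • ξ) ξ r := by
    simpa using ((hasDerivAt_id r).smul_const ξ).const_add x
  exact h1.comp_hasDerivAt r h2

lemma line_deriv2 {d : ℕ} {φ : EuclideanSpace ℝ (Fin d) → ℝ} (hφ : ContDiff ℝ 2 φ)
    (x ξ ζ : EuclideanSpace ℝ (Fin d)) (r : ℝ) :
    HasDerivAt (fun r : ℝ => fderiv ℝ φ (x + r • ξ) ζ)
      (fderiv ℝ (fderiv ℝ φ) (x + r • ξ) ξ ζ) r := by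
  have h0 : ContDiff ℝ 1 (fderiv ℝ φ) := hφ.fderiv_right (by norm_num)
  have h1 : HasFDerivAt (fderiv ℝ φ) (fderiv ℝ (fderiv ℝ φ) (x + r • ξ)) (x + r • ξ) :=
    ((h0.differentiable (by norm_num)) _).hasFDerivAt
  have h2 : HasDerivAt (fun r : ℝ => x + r • ξ) ξ r := by
    simpa using ((hasDerivAt_id r).smul_const ξ).const_add x
  have h3 := h1.comp_hasDerivAt r h2
  simpa using h3.clm_apply (hasDerivAt_const r ζ)

/-- Pointwise ellipticity of a matrix. -/
def Ell (d : ℕ) (ν : ℝ) (A : Matrix (Fin d) (Fin d) ℝ) : Prop :=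
  ∀ ξ : Fin d → ℝ, ν * ∑ i, ξ i ^ 2 ≤ ∑ i, ∑ j, A i j * ξ i * ξ j ∧
      ∑ i, ∑ j, A i j * ξ i * ξ j ≤ ν⁻¹ * ∑ i, ξ i ^ 2

lemma ell_diag {d : ℕ} {ν : ℝ} {A : Matrix (Fin d) (Fin d) ℝ} (hE : Ell d ν A) (i : Fin d) :
    ν ≤ A i i ∧ A i i ≤ ν⁻¹ := by
  have := hE (Pi.single i 1)
  simpa [Pi.single_apply, Finset.sum_ite_eq, ite_pow] using this

open scoped MatrixOrder in
lemma ell_decomp {d : ℕ} {ν : ℝ} (hν : 0 < ν) {A : Matrix (Fin d) (Fin d) ℝ} (hE : Ell d ν A)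
    (hs : ∀ i j, A i j = A j i) (e : EuclideanSpace ℝ (Fin d)) (he : ‖e‖ ≤ 1) :
    ∃ B : Fin d → EuclideanSpace ℝ (Fin d),
      (∀ H : EuclideanSpace ℝ (Fin d) →L[ℝ] EuclideanSpace ℝ (Fin d) →L[ℝ] ℝ,
        ∑ i, ∑ j, A i j * H (EuclideanSpace.single i 1) (EuclideanSpace.single j 1)
          = ν * H e e + ∑ k, H (B k) (B k)) ∧
      ∑ k, ‖B k‖ ^ 2 ≤ d * ν⁻¹ := by
  have hP : (Matrix.of fun i j => A i j - ν * (e i * e j) :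
      Matrix (Fin d) (Fin d) ℝ).PosSemidef := by
    refine Matrix.PosSemidef.of_dotProduct_mulVec_nonneg ?_ ?_
    · ext i j
      simp [Matrix.conjTranspose_apply, hs i j, mul_comm]
    · intro ξ
      have h1 := (hE ξ).1
      have h2 : (∑ i, e i * ξ i) ^ 2 ≤ (∑ i, e i ^ 2) * ∑ i, ξ i ^ 2 :=
        Finset.sum_mul_sq_le_sq_mul_sq _ _ _
      have h3 : ∑ i, e i ^ 2 ≤ 1 := by
        have := EuclideanSpace.real_norm_sq_eq e
        rw [← this]
        nlinarith [norm_nonneg e]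
      have h4 : (∑ i, e i * ξ i) ^ 2 ≤ ∑ i, ξ i ^ 2 := by
        have : 0 ≤ ∑ i, ξ i ^ 2 := Finset.sum_nonneg fun i _ => sq_nonneg _
        nlinarith
      have h5 : star ξ ⬝ᵥ (Matrix.of fun i j => A i j - ν * (e i * e j) :
          Matrix (Fin d) (Fin d) ℝ).mulVec ξ
          = ∑ i, ∑ j, A i j * ξ i * ξ j - ν * (∑ i, e i * ξ i) ^ 2 := by
        simp only [dotProduct, Matrix.mulVec, Matrix.of_apply, star_trivial]
        rw [sq, Finset.sum_mul_sum, Finset.mul_sum, ← Finset.sum_sub_distrib]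
        refine Finset.sum_congr rfl fun i _ => ?_
        rw [Finset.mul_sum, Finset.mul_sum, ← Finset.sum_sub_distrib]
        refine Finset.sum_congr rfl fun j _ => ?_
        ring
      rw [h5]
      nlinarith
  obtain ⟨B, hB⟩ := CStarAlgebra.nonneg_iff_eq_star_mul_self.mp hP.nonneg
  have hAB : ∀ i j, A i j = ν * (e i * e j) + ∑ k, B k i * B k j := by
    intro i j
    have := congrFun (congrFun hB i) j
    simp [Matrix.mul_apply, Matrix.star_eq_conjTranspose] at this
    linarith
  have hx : ∀ x : EuclideanSpace ℝ (Fin d), x = ∑ i, x i • EuclideanSpace.single i (1 : ℝ) := by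
    intro x
    ext j
    simp [Finset.sum_apply, Pi.single_apply]
  have hH : ∀ (H : EuclideanSpace ℝ (Fin d) →L[ℝ] EuclideanSpace ℝ (Fin d) →L[ℝ] ℝ)
      (x : EuclideanSpace ℝ (Fin d)), H x x = ∑ i, ∑ j, (x i * x j) *
        H (EuclideanSpace.single i 1) (EuclideanSpace.single j 1) := by
    intro H x
    conv_lhs => rw [hx x]
    simp only [map_sum, map_smul, FunLike.coe_sum, Finset.sum_apply,
      smul_apply, smul_eq_mul, Finset.mul_sum]
    rw [Finset.sum_comm]
    refine Finset.sum_congr rfl fun i _ => Finset.sum_congr rfl fun j _ => ?_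
    ring
  have key : ∀ H : EuclideanSpace ℝ (Fin d) →L[ℝ] EuclideanSpace ℝ (Fin d) →L[ℝ] ℝ,
        ∑ i, ∑ j, A i j * H (EuclideanSpace.single i 1) (EuclideanSpace.single j 1)
          = ν * H e e + ∑ k, H (WithLp.toLp 2 (B k)) (WithLp.toLp 2 (B k)) := by
    intro H
    rw [hH H e]
    simp_rw [fun k => hH H (WithLp.toLp 2 (B k)), hAB]
    rw [Finset.sum_comm, Finset.sum_comm (s := Finset.univ) (t := Finset.univ)
      (f := fun k i => ∑ j, _)]
    rw [Finset.sum_comm, Finset.mul_sum, ← Finset.sum_add_distrib]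
    refine Finset.sum_congr rfl fun i _ => ?_
    rw [Finset.sum_comm, Finset.mul_sum, ← Finset.sum_add_distrib]
    refine Finset.sum_congr rfl fun j _ => ?_
    rw [add_mul, Finset.sum_mul]
    ring
  refine ⟨fun k => WithLp.toLp 2 (B k), key, ?_⟩
  obtain ⟨I, hI⟩ : ∃ I : EuclideanSpace ℝ (Fin d) →L[ℝ] EuclideanSpace ℝ (Fin d) →L[ℝ] ℝ,
      ∀ x y, I x y = inner ℝ x y := ⟨innerSL ℝ, fun _ _ => rfl⟩
  have h1 := key I
  simp only [hI] at h1
  have h2 : ∑ i, ∑ j, A i j * inner ℝ (EuclideanSpace.single i (1 : ℝ))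
      (EuclideanSpace.single j (1 : ℝ)) = ∑ i, A i i := by
    refine Finset.sum_congr rfl fun i _ => ?_
    simp [EuclideanSpace.inner_single_left]
  rw [h2] at h1
  have h3 : ∑ i, A i i ≤ d * ν⁻¹ := by
    calc ∑ i, A i i ≤ ∑ _i : Fin d, ν⁻¹ := Finset.sum_le_sum fun i _ => (ell_diag hE i).2
      _ = _ := by simp
  simp only [real_inner_self_eq_norm_sq] at h1
  have : 0 ≤ ν * ‖e‖ ^ 2 := by positivity
  linarith

/-- The working regularity of functions on the half space. -/
def Reg {d : ℕ} (w : ℝ → EuclideanSpace ℝ (Fin d) → ℝ) : Prop :=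
  (∀ t < 0, ∀ x, DifferentiableAt ℝ (fun s => w s x) t) ∧
  (∀ t < 0, ContDiff ℝ 2 (w t)) ∧
  ContinuousOn (fun z : ℝ × EuclideanSpace ℝ (Fin d) => w z.1 z.2) (parNeg d)

/-- The parabolic operator with coefficients `A`. -/
def Lop {d : ℕ} (A : ℝ → EuclideanSpace ℝ (Fin d) → Matrix (Fin d) (Fin d) ℝ)
    (w : ℝ → EuclideanSpace ℝ (Fin d) → ℝ) (t : ℝ) (x : EuclideanSpace ℝ (Fin d)) : ℝ :=
  td w t x - ∑ i, ∑ j, A t x i j * sd2 i j (w t) x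

lemma hess_step {d : ℕ} {φ : EuclideanSpace ℝ (Fin d) → ℝ} (hφ : ContDiff ℝ 2 φ)
    (x e ξ : EuclideanSpace ℝ (Fin d)) (s c η : ℝ)
    (hm : ∀ y, φ (y + s • e) - φ (y - s • e) - c - η * ‖y‖ ^ 2 ≤
      φ (x + s • e) - φ (x - s • e) - c - η * ‖x‖ ^ 2) :
    fderiv ℝ (fderiv ℝ φ) (x + s • e) ξ ξ - fderiv ℝ (fderiv ℝ φ) (x - s • e) ξ ξ
      ≤ 2 * η * ‖ξ‖ ^ 2 := by
  have hN : ∀ r : ℝ, ‖x + r • ξ‖ ^ 2 = ‖x‖ ^ 2 + 2 * r * inner ℝ x ξ + r ^ 2 * ‖ξ‖ ^ 2 := by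
    intro r
    rw [norm_add_sq_real, inner_smul_right, norm_smul, mul_pow, Real.norm_eq_abs, sq_abs]
    ring
  have h1 : ∀ r, HasDerivAt (fun r : ℝ => φ ((x + s • e) + r • ξ) - φ ((x - s • e) + r • ξ)
      - η * (‖x‖ ^ 2 + 2 * r * inner ℝ x ξ + r ^ 2 * ‖ξ‖ ^ 2))
      (fderiv ℝ φ ((x + s • e) + r • ξ) ξ - fderiv ℝ φ ((x - s • e) + r • ξ) ξ
        - η * (2 * inner ℝ x ξ + 2 * r * ‖ξ‖ ^ 2)) r := by
    intro r
    refine ((line_deriv hφ _ _ r).sub (line_deriv hφ _ _ r)).sub (HasDerivAt.const_mul _ ?_)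
    have h := ((((hasDerivAt_id r).const_mul 2).mul_const (inner ℝ x ξ)).const_add
      (‖x‖ ^ 2)).add (((hasDerivAt_id r).pow 2).mul_const (‖ξ‖ ^ 2))
    exact h.congr_deriv (by simp)
  have h2 : HasDerivAt (fun r : ℝ => fderiv ℝ φ ((x + s • e) + r • ξ) ξ
      - fderiv ℝ φ ((x - s • e) + r • ξ) ξ - η * (2 * inner ℝ x ξ + 2 * r * ‖ξ‖ ^ 2))
      (fderiv ℝ (fderiv ℝ φ) ((x + s • e) + (0:ℝ) • ξ) ξ ξ
      - fderiv ℝ (fderiv ℝ φ) ((x - s • e) + (0:ℝ) • ξ) ξ ξ - η * (2 * ‖ξ‖ ^ 2)) 0 := by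
    refine ((line_deriv2 hφ _ _ _ 0).sub (line_deriv2 hφ _ _ _ 0)).sub
      (HasDerivAt.const_mul _ ?_)
    have h := (((hasDerivAt_id (0:ℝ)).const_mul 2).mul_const (‖ξ‖ ^ 2)).const_add
      (2 * inner ℝ x ξ)
    exact h.congr_deriv (by simp)
  have h3 := second_deriv_nonpos h1 h2 (Eventually.of_forall fun r => by
    have := hm (x + r • ξ)
    beta_reduce
    rw [← hN r]
    simp only [zero_smul, add_zero, mul_zero, zero_mul]
    have e1 : x + r • ξ + s • e = x + s • e + r • ξ := by abel
    have e2 : x + r • ξ - s • e = x - s • e + r • ξ := by abel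
    rw [e1, e2] at this
    norm_num
    linarith)
  simp only [zero_smul, add_zero] at h3
  linarith

lemma hess_step_s {d : ℕ} {φ : EuclideanSpace ℝ (Fin d) → ℝ} (hφ : ContDiff ℝ 2 φ)
    (x e : EuclideanSpace ℝ (Fin d)) (s R α β : ℝ) (hs : s ∈ Ioo 0 R)
    (hm : ∀ r ∈ Icc 0 R, φ (x + r • e) - φ (x - r • e) - (α * r - β * r ^ 2) ≤
      φ (x + s • e) - φ (x - s • e) - (α * s - β * s ^ 2)) :
    fderiv ℝ (fderiv ℝ φ) (x + s • e) e e - fderiv ℝ (fderiv ℝ φ) (x - s • e) e e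
      ≤ - (2 * β) := by
  have h1 : ∀ r, HasDerivAt (fun r : ℝ => φ ((x + s • e) + r • e) - φ ((x - s • e) + r • (-e))
      - (α * (s + r) - β * (s + r) ^ 2))
      (fderiv ℝ φ ((x + s • e) + r • e) e - fderiv ℝ φ ((x - s • e) + r • (-e)) (-e)
        - (α - β * (2 * (s + r)))) r := by
    intro r
    refine ((line_deriv hφ _ _ r).sub (line_deriv hφ _ _ r)).sub ?_
    have h0 := (hasDerivAt_id r).const_add s
    have h := (h0.const_mul α).sub ((h0.pow 2).const_mul β)
    exact h.congr_deriv (by simp)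
  have h2 : HasDerivAt (fun r : ℝ => fderiv ℝ φ ((x + s • e) + r • e) e
        - fderiv ℝ φ ((x - s • e) + r • (-e)) (-e) - (α - β * (2 * (s + r))))
      (fderiv ℝ (fderiv ℝ φ) ((x + s • e) + (0:ℝ) • e) e e
      - fderiv ℝ (fderiv ℝ φ) ((x - s • e) + (0:ℝ) • (-e)) (-e) (-e) - (- (β * 2))) 0 := by
    refine ((line_deriv2 hφ _ _ _ 0).sub (line_deriv2 hφ _ _ _ 0)).sub ?_
    have h0 := ((((hasDerivAt_id (0:ℝ)).const_add s).const_mul 2).const_mul β).const_sub α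
    exact h0.congr_deriv (by simp)
  have h3 := second_deriv_nonpos h1 h2 (by
    have : Ioo (-s) (R - s) ∈ nhds (0:ℝ) := Ioo_mem_nhds (by linarith [hs.1]) (by linarith [hs.2])
    filter_upwards [this] with r hr
    have := hm (s + r) ⟨by linarith [hr.1], by linarith [hr.2]⟩
    simp only [zero_smul, add_zero]
    have e1 : x + (s + r) • e = x + s • e + r • e := by rw [add_smul]; abel
    have e2 : x - (s + r) • e = x - s • e + r • (-e) := by rw [add_smul, smul_neg]; abel
    rw [e1, e2] at this
    exact this)
  simp only [zero_smul, add_zero, map_neg, neg_apply, neg_neg] at h3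
  linarith

lemma key_strict {d : ℕ} {ν : ℝ} (hν : 0 < ν)
    {A : ℝ → EuclideanSpace ℝ (Fin d) → Matrix (Fin d) (Fin d) ℝ}
    (hE : ∀ t < 0, ∀ x, Ell d ν (A t x)) (hs : ∀ t < 0, ∀ x i j, A t x i j = A t x j i)
    {w : ℝ → EuclideanSpace ℝ (Fin d) → ℝ} (hw : Reg w) {W G β R : ℝ}
    (e : EuclideanSpace ℝ (Fin d)) (he : ‖e‖ ≤ 1)
    (hinv : ∀ t < 0, ∀ x (s : ℝ), A t (x + s • e) = A t x)
    (hW : ∀ t < 0, ∀ x, |w t x| ≤ W) (hG : ∀ t < 0, ∀ x, |Lop A w t x| ≤ G)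
    (hG0 : 0 ≤ G) (hβ : G < ν * β) (hR : 0 < R)
    {t1 : ℝ} (ht1 : t1 < 0) (x1 : EuclideanSpace ℝ (Fin d)) {s1 : ℝ} (hs1 : s1 ∈ Icc 0 R) :
    w t1 (x1 + s1 • e) - w t1 (x1 - s1 • e) ≤ (2 * W / R + β * R) * s1 - β * s1 ^ 2 := by
  obtain ⟨hw1, hw2, hw3⟩ := hw
  by_contra hcon
  push Not at hcon
  have hβ0 : 0 < β := by
    by_contra h
    push Not at h
    nlinarith
  have hW0 : 0 ≤ W := (abs_nonneg _).trans (hW t1 ht1 x1)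
  set α := 2 * W / R + β * R with hα
  have hαR : α * R - β * R ^ 2 = 2 * W := by rw [hα]; field_simp; ring
  have hb0 : ∀ s ∈ Icc 0 R, 0 ≤ α * s - β * s ^ 2 := by
    intro s hs
    have : 0 ≤ 2 * W / R := by positivity
    have h1 : β * s ≤ β * R := mul_le_mul_of_nonneg_left hs.2 hβ0.le
    nlinarith [hs.1]
  set m1 := w t1 (x1 + s1 • e) - w t1 (x1 - s1 • e) - (α * s1 - β * s1 ^ 2) with hm1
  have hm1p : 0 < m1 := by rw [hm1]; linarith
  obtain ⟨η, hη0, hη1, hη2⟩ : ∃ η : ℝ, 0 < η ∧ η * (‖x1‖ ^ 2 - t1) < m1 ∧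
      η * (2 * (d * ν⁻¹) + 1) < 2 * (ν * β - G) := by
    have hp1 : 0 < ‖x1‖ ^ 2 - t1 := by nlinarith [sq_nonneg ‖x1‖]
    have hp2 : 0 < 2 * (d * ν⁻¹) + 1 := by positivity
    have hp3 : 0 < 2 * (ν * β - G) := by linarith
    refine ⟨min (m1 / (‖x1‖ ^ 2 - t1)) (2 * (ν * β - G) / (2 * (d * ν⁻¹) + 1)) / 2, ?_, ?_, ?_⟩
    · positivity
    · have : min (m1 / (‖x1‖ ^ 2 - t1)) (2 * (ν * β - G) / (2 * (d * ν⁻¹) + 1)) / 2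
          < m1 / (‖x1‖ ^ 2 - t1) :=
        lt_of_lt_of_le (half_lt_self (by positivity)) (min_le_left _ _)
      rwa [lt_div_iff₀ hp1] at this
    · have : min (m1 / (‖x1‖ ^ 2 - t1)) (2 * (ν * β - G) / (2 * (d * ν⁻¹) + 1)) / 2
          < 2 * (ν * β - G) / (2 * (d * ν⁻¹) + 1) :=
        lt_of_lt_of_le (half_lt_self (by positivity)) (min_le_right _ _)
      rwa [lt_div_iff₀ hp2] at this
  let Φ : ℝ × EuclideanSpace ℝ (Fin d) × ℝ → ℝ := fun z =>
    w z.1 (z.2.1 + z.2.2 • e) - w z.1 (z.2.1 - z.2.2 • e) - (α * z.2.2 - β * z.2.2 ^ 2)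
      - η * (‖z.2.1‖ ^ 2 - z.1)
  set ρ := 2 * W / η + 1 with hρ
  have hρ1 : 1 ≤ ρ := by rw [hρ]; have : 0 ≤ 2 * W / η := by positivity
                         linarith
  let C : Set (ℝ × EuclideanSpace ℝ (Fin d) × ℝ) := Icc (-ρ) t1 ×ˢ (closedBall 0 ρ ×ˢ Icc 0 R)
  have hC : IsCompact C := isCompact_Icc.prod ((isCompact_closedBall _ _).prod isCompact_Icc)
  have hin : ∀ t x s, t ≤ t1 → s ∈ Icc 0 R → 0 < Φ (t, x, s) → (t, x, s) ∈ C := by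
    intro t x s ht hs hp
    have ht0 : t < 0 := by linarith
    have h1 := abs_le.1 (hW t ht0 (x + s • e))
    have h2 := abs_le.1 (hW t ht0 (x - s • e))
    have h3 := hb0 s hs
    have hp' : 0 < w t (x + s • e) - w t (x - s • e) - (α * s - β * s ^ 2)
      - η * (‖x‖ ^ 2 - t) := hp
    have h4 : η * (‖x‖ ^ 2 - t) < 2 * W := by linarith
    have h5 : ‖x‖ ^ 2 - t < 2 * W / η := by rw [lt_div_iff₀ hη0]; linarith
    refine ⟨⟨?_, ht⟩, ?_, hs⟩
    · show -ρ ≤ t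
      nlinarith [sq_nonneg ‖x‖]
    · rw [mem_closedBall_zero_iff]
      show ‖x‖ ≤ ρ
      by_contra hh
      push Not at hh
      nlinarith [norm_nonneg x]
  have hcont : ContinuousOn Φ C := by
    have ha : ContinuousOn (fun z : ℝ × EuclideanSpace ℝ (Fin d) × ℝ =>
        w z.1 (z.2.1 + z.2.2 • e)) C :=
      hw3.comp (f := fun z : ℝ × EuclideanSpace ℝ (Fin d) × ℝ => (z.1, z.2.1 + z.2.2 • e))
        (by fun_prop) (fun z hz => ⟨lt_of_le_of_lt hz.1.2 ht1, mem_univ _⟩)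
    have hb : ContinuousOn (fun z : ℝ × EuclideanSpace ℝ (Fin d) × ℝ =>
        w z.1 (z.2.1 - z.2.2 • e)) C :=
      hw3.comp (f := fun z : ℝ × EuclideanSpace ℝ (Fin d) × ℝ => (z.1, z.2.1 - z.2.2 • e))
        (by fun_prop) (fun z hz => ⟨lt_of_le_of_lt hz.1.2 ht1, mem_univ _⟩)
    exact ((ha.sub hb).sub (by fun_prop)).sub (by fun_prop)
  have hΦ1 : 0 < Φ (t1, x1, s1) := by
    show 0 < w t1 (x1 + s1 • e) - w t1 (x1 - s1 • e) - (α * s1 - β * s1 ^ 2)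
      - η * (‖x1‖ ^ 2 - t1)
    linarith
  have h1C := hin t1 x1 s1 le_rfl hs1 hΦ1
  obtain ⟨⟨t, x, s⟩, hzC, hmax⟩ := hC.exists_isMaxOn ⟨_, h1C⟩ hcont
  have hpos : 0 < Φ (t, x, s) := lt_of_lt_of_le hΦ1 (hmax h1C)
  have hle : ∀ t' x' s', t' ≤ t1 → s' ∈ Icc 0 R → Φ (t', x', s') ≤ Φ (t, x, s) := by
    intro t' x' s' h1 h2
    by_cases hp : 0 < Φ (t', x', s')
    · exact hmax (hin t' x' s' h1 h2 hp)
    · linarith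
  have htt : t ≤ t1 := hzC.1.2
  have ht0 : t < 0 := by linarith
  have hsR : s ∈ Icc 0 R := hzC.2.2
  simp only [Φ] at hle hpos
  have hpen : 0 ≤ η * (‖x‖ ^ 2 - t) := by
    have := sq_nonneg ‖x‖
    have : 0 ≤ ‖x‖ ^ 2 - t := by linarith
    positivity
  have hs0 : s ≠ 0 := by
    rintro rfl
    simp at hpos
    nlinarith
  have hsR' : s ≠ R := by
    rintro rfl
    have h1 := abs_le.1 (hW t ht0 (x + s • e))
    have h2 := abs_le.1 (hW t ht0 (x - s • e))
    linarith
  have hsI : s ∈ Ioo 0 R := ⟨lt_of_le_of_ne hsR.1 hs0.symm, lt_of_le_of_ne hsR.2 hsR'⟩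
  have hT : 0 ≤ td w t (x + s • e) - td w t (x - s • e) + η := by
    have hd : HasDerivAt (fun τ => w τ (x + s • e) - w τ (x - s • e) - (α * s - β * s ^ 2)
        - η * (‖x‖ ^ 2 - τ)) (td w t (x + s • e) - td w t (x - s • e) + η) t := by
      have h := (((hw1 t ht0 (x + s • e)).hasDerivAt.sub
        (hw1 t ht0 (x - s • e)).hasDerivAt).sub_const (α * s - β * s ^ 2)).sub
          (((hasDerivAt_id t).const_sub (‖x‖ ^ 2)).const_mul η)
      exact h.congr_deriv (by simp [td])
    by_contra hneg
    push Not at hneg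
    have h1 := hd.hasDerivWithinAt (s := Iio t)
    rw [hasDerivWithinAt_iff_tendsto_slope' (by simp)] at h1
    have h2 : ∀ᶠ τ in nhdsWithin t (Iio t), slope (fun τ => w τ (x + s • e) - w τ (x - s • e)
        - (α * s - β * s ^ 2) - η * (‖x‖ ^ 2 - τ)) t τ < 0 := h1.eventually (gt_mem_nhds hneg)
    obtain ⟨τ, hτ1, hτ2⟩ := (h2.and self_mem_nhdsWithin).exists
    have h3 := hle τ x s (by linarith [show τ < t from hτ2]) hsR
    rw [slope_def_field, div_lt_iff_of_neg (by linarith [show τ < t from hτ2])] at hτ1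
    linarith
  have hφ := hw2 t ht0
  have hX : ∀ ξ, fderiv ℝ (fderiv ℝ (w t)) (x + s • e) ξ ξ
      - fderiv ℝ (fderiv ℝ (w t)) (x - s • e) ξ ξ ≤ 2 * η * ‖ξ‖ ^ 2 := by
    intro ξ
    refine hess_step hφ x e ξ s (α * s - β * s ^ 2) η fun y => ?_
    have := hle t y s htt hsR
    linarith
  have hS : fderiv ℝ (fderiv ℝ (w t)) (x + s • e) e e
      - fderiv ℝ (fderiv ℝ (w t)) (x - s • e) e e ≤ - (2 * β) := by
    refine hess_step_s hφ x e s R α β hsI fun r hr => ?_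
    have := hle t x r htt hr
    linarith
  obtain ⟨B, hB1, hB2⟩ := ell_decomp hν (hE t ht0 x) (hs t ht0 x) e he
  have hA1 : A t (x + s • e) = A t x := hinv t ht0 x s
  have hA2 : A t (x - s • e) = A t x := by
    have := hinv t ht0 x (-s)
    rwa [neg_smul, ← sub_eq_add_neg] at this
  have hL1 := abs_le.1 (hG t ht0 (x + s • e))
  have hL2 := abs_le.1 (hG t ht0 (x - s • e))
  simp only [Lop, hA1, hA2, sd2_eq hφ, hB1] at hL1 hL2
  have hsum : ∑ k, fderiv ℝ (fderiv ℝ (w t)) (x + s • e) (B k) (B k)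
      - ∑ k, fderiv ℝ (fderiv ℝ (w t)) (x - s • e) (B k) (B k) ≤ 2 * η * (d * ν⁻¹) := by
    rw [← Finset.sum_sub_distrib]
    calc _ ≤ ∑ k, 2 * η * ‖B k‖ ^ 2 := Finset.sum_le_sum fun k _ => hX (B k)
      _ = 2 * η * ∑ k, ‖B k‖ ^ 2 := by rw [Finset.mul_sum]
      _ ≤ _ := mul_le_mul_of_nonneg_left hB2 (by positivity)
  have hS' := mul_le_mul_of_nonneg_left hS hν.le
  linarith [hL1.2, hL2.1]

/-- The Lipschitz estimate in direction `e`. -/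
lemma key_est {d : ℕ} {ν : ℝ} (hν : 0 < ν)
    {A : ℝ → EuclideanSpace ℝ (Fin d) → Matrix (Fin d) (Fin d) ℝ}
    (hE : ∀ t < 0, ∀ x, Ell d ν (A t x)) (hs : ∀ t < 0, ∀ x i j, A t x i j = A t x j i)
    {w : ℝ → EuclideanSpace ℝ (Fin d) → ℝ} (hw : Reg w) {W G R : ℝ}
    (e : EuclideanSpace ℝ (Fin d)) (he : ‖e‖ ≤ 1)
    (hinv : ∀ t < 0, ∀ x (s : ℝ), A t (x + s • e) = A t x)
    (hW : ∀ t < 0, ∀ x, |w t x| ≤ W) (hG : ∀ t < 0, ∀ x, |Lop A w t x| ≤ G)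
    (hG0 : 0 ≤ G) (hR : 0 < R)
    {t : ℝ} (ht : t < 0) (x : EuclideanSpace ℝ (Fin d)) {s : ℝ} (hsR : s ∈ Icc 0 R) :
    w t (x + s • e) - w t (x - s • e) ≤ (2 * W / R + G / ν * R) * s := by
  have hlim : Tendsto (fun β : ℝ => (2 * W / R + β * R) * s) (nhdsWithin (G / ν) (Ioi (G / ν)))
      (nhds ((2 * W / R + G / ν * R) * s)) := by
    refine Tendsto.mono_left (Continuous.tendsto ?_ _) nhdsWithin_le_nhds
    fun_prop
  refine ge_of_tendsto hlim ?_
  filter_upwards [self_mem_nhdsWithin] with β hβ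
  have hβ' : G < ν * β := by
    rw [mem_Ioi, div_lt_iff₀ hν] at hβ
    linarith
  have hβ0 : 0 ≤ β := le_of_lt (lt_of_le_of_lt (by positivity) (mem_Ioi.1 hβ))
  have := key_strict hν hE hs hw e he hinv hW hG hG0 hβ' hR ht x hsR
  nlinarith [mul_nonneg hβ0 (sq_nonneg s)]

/-- Finite difference in the space variables. -/
def dl {d : ℕ} (h : EuclideanSpace ℝ (Fin d)) (w : ℝ → EuclideanSpace ℝ (Fin d) → ℝ) :
    ℝ → EuclideanSpace ℝ (Fin d) → ℝ := fun t x => w t (x + h) - w t x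

/-- Vectors in the `x'` directions. -/
def Vx {d : ℕ} (q : ℕ) (h : EuclideanSpace ℝ (Fin d)) : Prop :=
  ∀ i : Fin d, q ≤ (i : ℕ) → h i = 0

lemma Vx.add {d q : ℕ} {h k : EuclideanSpace ℝ (Fin d)} (hh : Vx q h) (hk : Vx q k) :
    Vx q (h + k) := fun i hi => by simp [hh i hi, hk i hi]

lemma Vx.smul {d q : ℕ} {h : EuclideanSpace ℝ (Fin d)} (hh : Vx q h) (c : ℝ) :
    Vx q (c • h) := fun i hi => by simp [hh i hi]

lemma reg_dl {d : ℕ} {w : ℝ → EuclideanSpace ℝ (Fin d) → ℝ} (hw : Reg w)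
    (h : EuclideanSpace ℝ (Fin d)) : Reg (dl h w) := by
  obtain ⟨h1, h2, h3⟩ := hw
  refine ⟨fun t ht x => (h1 t ht (x + h)).sub (h1 t ht x), fun t ht => ?_, ?_⟩
  · exact ((h2 t ht).comp (contDiff_id.add contDiff_const)).sub (h2 t ht)
  · refine ContinuousOn.sub ?_ h3
    exact h3.comp (f := fun z : ℝ × EuclideanSpace ℝ (Fin d) => (z.1, z.2 + h))
      (by fun_prop) (fun z hz => ⟨hz.1, mem_univ _⟩)

lemma sd2_diff {d : ℕ} {φ : EuclideanSpace ℝ (Fin d) → ℝ} (hφ : ContDiff ℝ 2 φ) (i j : Fin d)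
    (h x : EuclideanSpace ℝ (Fin d)) :
    sd2 i j (fun y => φ (y + h) - φ y) x = sd2 i j φ (x + h) - sd2 i j φ x := by
  have hφ' : ContDiff ℝ 2 (fun y => φ (y + h)) := hφ.comp (contDiff_id.add contDiff_const)
  have h1 : Differentiable ℝ φ := hφ.differentiable (by norm_num)
  have h1' : Differentiable ℝ (fun y => φ (y + h)) := hφ'.differentiable (by norm_num)
  have h2 : Differentiable ℝ (fderiv ℝ φ) :=
    (hφ.fderiv_right (m := 1) (by norm_num)).differentiable (by norm_num)
  have h2' : Differentiable ℝ (fun y => fderiv ℝ φ (y + h)) :=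
    h2.comp (differentiable_id.add_const h)
  have e1 : fderiv ℝ (fun y => φ (y + h) - φ y) = fun y => fderiv ℝ φ (y + h) - fderiv ℝ φ y := by
    funext y
    rw [fderiv_fun_sub (h1' y) (h1 y), fderiv_comp_add_right]
  rw [sd2_eq (hφ'.sub hφ), sd2_eq hφ, sd2_eq hφ, e1, fderiv_fun_sub (h2' x) (h2 x),
    fderiv_comp_add_right]
  simp

lemma Lop_dl {d : ℕ} {A : ℝ → EuclideanSpace ℝ (Fin d) → Matrix (Fin d) (Fin d) ℝ}
    {w : ℝ → EuclideanSpace ℝ (Fin d) → ℝ} (hw : Reg w) {h : EuclideanSpace ℝ (Fin d)}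
    {t : ℝ} (ht : t < 0) {x : EuclideanSpace ℝ (Fin d)} (hA : A t (x + h) = A t x) :
    Lop A (dl h w) t x = Lop A w t (x + h) - Lop A w t x := by
  have h1 : td (dl h w) t x = td w t (x + h) - td w t x :=
    deriv_fun_sub (hw.1 t ht _) (hw.1 t ht _)
  have h2 : ∀ i j, sd2 i j (dl h w t) x = sd2 i j (w t) (x + h) - sd2 i j (w t) x :=
    fun i j => sd2_diff (hw.2.1 t ht) i j h x
  simp only [Lop, h1, h2, hA, mul_sub, Finset.sum_sub_distrib]
  ring

lemma rpow_two_add {r δ : ℝ} (hr : 0 < r) : r ^ (2 + δ) = r ^ 2 * r ^ δ := by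
  rw [Real.rpow_add hr]; norm_num

/-- Doubling identity for third differences. -/
lemma dl_double {d : ℕ} (u : ℝ → EuclideanSpace ℝ (Fin d) → ℝ)
    (h1 h2 h3 : EuclideanSpace ℝ (Fin d)) (t : ℝ) (x : EuclideanSpace ℝ (Fin d)) :
    dl (h1 + h1) (dl (h2 + h2) (dl (h3 + h3) u)) t x =
      dl h1 (dl h2 (dl h3 u)) t x + dl h1 (dl h2 (dl h3 u)) t (x + h1)
      + dl h1 (dl h2 (dl h3 u)) t (x + h2) + dl h1 (dl h2 (dl h3 u)) t (x + h3)
      + dl h1 (dl h2 (dl h3 u)) t (x + (h1 + h2)) + dl h1 (dl h2 (dl h3 u)) t (x + (h1 + h3))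
      + dl h1 (dl h2 (dl h3 u)) t (x + (h2 + h3))
      + dl h1 (dl h2 (dl h3 u)) t (x + (h1 + h2 + h3)) := by
  simp only [dl, ← add_assoc]
  simp only [add_right_comm _ h2 h1, add_right_comm _ h3 h1, add_right_comm _ h3 h2]
  ring

section main
variable {d q : ℕ} {ν δ K : ℝ}

lemma third_step (hν : 0 < ν) (hδ : δ ∈ Ioo (0 : ℝ) 1) (hK : 0 ≤ K)
    {A : ℝ → EuclideanSpace ℝ (Fin d) → Matrix (Fin d) (Fin d) ℝ}
    (hE : ∀ t < 0, ∀ x, Ell d ν (A t x)) (hs : ∀ t < 0, ∀ x i j, A t x i j = A t x j i)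
    (hinv : ∀ t < 0, ∀ x h, Vx q h → A t (x + h) = A t x)
    {u : ℝ → EuclideanSpace ℝ (Fin d) → ℝ} (hu : Reg u)
    (hF : ∀ t < 0, ∀ x h, Vx q h → |Lop A u t (x + h) - Lop A u t x| ≤ K * ‖h‖ ^ δ)
    {N : ℝ} (hN : 3 / 2 ≤ N) {r0 B : ℝ} (hr0 : 0 < r0)
    (hB : ∀ r, r0 ≤ r → ∀ h1 h2 h3 : EuclideanSpace ℝ (Fin d), Vx q h1 → Vx q h2 → Vx q h3 →
      ‖h1‖ ≤ r → ‖h2‖ ≤ r → ‖h3‖ ≤ r → ∀ t < 0, ∀ x,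
        |dl h1 (dl h2 (dl h3 u)) t x| ≤ B * r ^ (2 + δ)) :
    ∀ r, r0 ≤ r → ∀ h1 h2 h3 : EuclideanSpace ℝ (Fin d), Vx q h1 → Vx q h2 → Vx q h3 →
      ‖h1‖ ≤ r → ‖h2‖ ≤ r → ‖h3‖ ≤ r → ∀ t < 0, ∀ x,
        |dl h1 (dl h2 (dl h3 u)) t x| ≤
          ((2 ^ (2 + δ) + 21 / N) / 8 * B + 42 * N / (8 * ν) * K) * r ^ (2 + δ) := by
  intro r hr h1 h2 h3 v1 v2 v3 n1 n2 n3 t ht x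
  have hrp : 0 < r := by linarith
  have hNp : 0 < N := by linarith
  set w := dl h1 (dl h2 (dl h3 u)) with hw
  have hwW : ∀ t < 0, ∀ x, |w t x| ≤ B * r ^ (2 + δ) :=
    fun t ht x => hB r hr h1 h2 h3 v1 v2 v3 n1 n2 n3 t ht x
  have hrw : Reg w := reg_dl (reg_dl (reg_dl hu _) _) _
  have hrδ : 0 < r ^ δ := Real.rpow_pos_of_pos hrp _
  have hG : ∀ t < 0, ∀ x, |Lop A w t x| ≤ 4 * (K * r ^ δ) := by
    intro t ht x
    have hF' : ∀ x, |Lop A u t (x + h3) - Lop A u t x| ≤ K * r ^ δ := fun x =>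
      (hF t ht x h3 v3).trans (mul_le_mul_of_nonneg_left
        (Real.rpow_le_rpow (norm_nonneg _) n3 hδ.1.le) hK)
    have e : ∀ y, Lop A (dl h3 u) t y = Lop A u t (y + h3) - Lop A u t y := fun y =>
      Lop_dl hu ht (hinv t ht _ _ v3)
    have e2 : ∀ y, Lop A (dl h2 (dl h3 u)) t y =
        Lop A (dl h3 u) t (y + h2) - Lop A (dl h3 u) t y := fun y =>
      Lop_dl (reg_dl hu _) ht (hinv t ht _ _ v2)
    rw [hw, Lop_dl (reg_dl (reg_dl hu _) _) ht (hinv t ht _ _ v1), e2, e2, e, e, e, e]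
    have a1 := abs_le.1 (hF' (x + h1 + h2))
    have a2 := abs_le.1 (hF' (x + h1))
    have a3 := abs_le.1 (hF' (x + h2))
    have a4 := abs_le.1 (hF' x)
    rw [abs_le]
    constructor <;> linarith [a1.1, a1.2, a2.1, a2.2, a3.1, a3.2, a4.1, a4.2]
  have hG0 : 0 ≤ 4 * (K * r ^ δ) := by positivity
  set E := (3 * B / N + 6 * K * N / ν) * r ^ (2 + δ) with hEdef
  have half : ∀ β, Vx q β → ‖β‖ ≤ 3 * r → ∀ y, w t (y + β) - w t y ≤ E := by
    intro β vβ nβ y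
    have he : ‖(3 * r)⁻¹ • β‖ ≤ 1 := by
      rw [norm_smul, Real.norm_eq_abs, abs_of_pos (by positivity), inv_mul_le_iff₀ (by positivity)]
      linarith
    have := key_est hν hE hs hrw ((3 * r)⁻¹ • β) he
      (fun t ht x s => hinv t ht x _ ((vβ.smul _).smul _)) hwW hG hG0
      (R := N * r) (by positivity) ht (y + (1 / 2 : ℝ) • β) (s := 3 / 2 * r)
      ⟨by positivity, mul_le_mul_of_nonneg_right hN hrp.le⟩
    have e1 : (3 / 2 * r) • (3 * r)⁻¹ • β = (1 / 2 : ℝ) • β := by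
      rw [smul_smul]; congr 1; field_simp
    rw [e1, add_sub_cancel_right, add_assoc, ← add_smul] at this
    rw [show (1 / 2 + 1 / 2 : ℝ) = 1 by norm_num, one_smul] at this
    refine this.trans (le_of_eq ?_)
    rw [hEdef, rpow_two_add hrp]
    field_simp
    ring
  have full : ∀ β, Vx q β → ‖β‖ ≤ 3 * r → |w t (x + β) - w t x| ≤ E := by
    intro β vβ nβ
    rw [abs_le]
    refine ⟨?_, half β vβ nβ x⟩
    have := half ((-1 : ℝ) • β) (vβ.smul _) (by rw [norm_smul]; simpa using nβ) (x + β)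
    rw [neg_one_smul, add_neg_cancel_right] at this
    linarith
  have hdb := hB (2 * r) (by linarith) (h1 + h1) (h2 + h2) (h3 + h3) (v1.add v1) (v2.add v2)
    (v3.add v3) ((norm_add_le _ _).trans (by linarith)) ((norm_add_le _ _).trans (by linarith))
    ((norm_add_le _ _).trans (by linarith)) t ht x
  rw [dl_double, ← hw, Real.mul_rpow (by norm_num) hrp.le] at hdb
  have b12 := (norm_add_le h1 h2)
  have b1 := abs_le.1 (full h1 v1 (by linarith))
  have b2 := abs_le.1 (full h2 v2 (by linarith))
  have b3 := abs_le.1 (full h3 v3 (by linarith))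
  have b4 := abs_le.1 (full (h1 + h2) (v1.add v2) ((norm_add_le _ _).trans (by linarith)))
  have b5 := abs_le.1 (full (h1 + h3) (v1.add v3) ((norm_add_le _ _).trans (by linarith)))
  have b6 := abs_le.1 (full (h2 + h3) (v2.add v3) ((norm_add_le _ _).trans (by linarith)))
  have b7 := abs_le.1 (full (h1 + h2 + h3) ((v1.add v2).add v3)
    ((norm_add_le _ _).trans (by linarith)))
  have hdb' := abs_le.1 hdb
  have hfin : ((2 ^ (2 + δ) + 21 / N) / 8 * B + 42 * N / (8 * ν) * K) * r ^ (2 + δ) =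
      (B * (2 ^ (2 + δ) * r ^ (2 + δ)) + 7 * E) / 8 := by
    rw [hEdef]; field_simp; ring
  rw [hfin, abs_le]
  constructor
  · linarith [b1.2, b2.2, b3.2, b4.2, b5.2, b6.2, b7.2, hdb'.1]
  · linarith [b1.1, b2.1, b3.1, b4.1, b5.1, b6.1, b7.1, hdb'.2]

/-- Third differences in the `x'` directions are controlled by the data. -/
lemma third_diff (hν : 0 < ν) (hδ : δ ∈ Ioo (0 : ℝ) 1) (d q : ℕ) :
    ∃ C : ℝ, 0 < C ∧ ∀ (K : ℝ), 0 ≤ K →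
    ∀ A : ℝ → EuclideanSpace ℝ (Fin d) → Matrix (Fin d) (Fin d) ℝ,
    (∀ t < 0, ∀ x, Ell d ν (A t x)) → (∀ t < 0, ∀ x i j, A t x i j = A t x j i) →
    (∀ t < 0, ∀ x h, Vx q h → A t (x + h) = A t x) →
    ∀ u : ℝ → EuclideanSpace ℝ (Fin d) → ℝ, Reg u → (∃ M, ∀ t < 0, ∀ x, |u t x| ≤ M) →
    (∀ t < 0, ∀ x h, Vx q h → |Lop A u t (x + h) - Lop A u t x| ≤ K * ‖h‖ ^ δ) →
    ∀ r, 0 < r → ∀ h1 h2 h3 : EuclideanSpace ℝ (Fin d), Vx q h1 → Vx q h2 → Vx q h3 →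
      ‖h1‖ ≤ r → ‖h2‖ ≤ r → ‖h3‖ ≤ r → ∀ t < 0, ∀ x,
        |dl h1 (dl h2 (dl h3 u)) t x| ≤ C * K * r ^ (2 + δ) := by
  set p : ℝ := 2 ^ (2 + δ) with hp
  have hp8 : p < 8 := by
    have : p < 2 ^ (3 : ℝ) := Real.rpow_lt_rpow_of_exponent_lt (by norm_num) (by linarith [hδ.2])
    norm_num at this
    exact this
  have hp0 : 0 < p := by positivity
  set N := 42 / (8 - p) with hN
  have h8p : 0 < 8 - p := by linarith
  have hN1 : 3 / 2 ≤ N := by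
    rw [hN, le_div_iff₀ h8p]; linarith
  have hN0 : 0 < N := by linarith
  set γ := (p + 21 / N) / 8 with hγ
  have hγ1 : γ < 1 := by
    have : 21 / N = (8 - p) / 2 := by rw [hN]; field_simp; norm_num
    rw [hγ, this]; linarith
  have hγ0 : 0 ≤ γ := by positivity
  set D := 42 * N / (8 * ν) with hD
  have hD0 : 0 < D := by positivity
  refine ⟨D / (1 - γ), div_pos hD0 (by linarith), ?_⟩
  intro K hK A hE hs hinv u hu hM hF r hr
  obtain ⟨M, hM⟩ := hM
  set T := D / (1 - γ) * K with hT
  have hTfix : γ * T + D * K = T := by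
    have : (1 - γ) ≠ 0 := by linarith
    rw [hT]; field_simp; ring
  set B0 := 8 * |M| / r ^ (2 + δ) with hB0
  have hiter : ∀ n : ℕ, ∀ r', r ≤ r' → ∀ h1 h2 h3 : EuclideanSpace ℝ (Fin d), Vx q h1 →
      Vx q h2 → Vx q h3 → ‖h1‖ ≤ r' → ‖h2‖ ≤ r' → ‖h3‖ ≤ r' → ∀ t < 0, ∀ x,
        |dl h1 (dl h2 (dl h3 u)) t x| ≤ (T + γ ^ n * (B0 - T)) * r' ^ (2 + δ) := by
    intro n
    induction n with
    | zero =>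
      intro r' hr' h1 h2 h3 v1 v2 v3 n1 n2 n3 t ht x
      have hb : ∀ y, |u t y| ≤ |M| := fun y => (hM t ht y).trans (le_abs_self _)
      have h8 : |dl h1 (dl h2 (dl h3 u)) t x| ≤ 8 * |M| := by
        simp only [dl]
        have c1 := abs_le.1 (hb (x + h1 + h2 + h3))
        have c2 := abs_le.1 (hb (x + h1 + h2))
        have c3 := abs_le.1 (hb (x + h1 + h3))
        have c4 := abs_le.1 (hb (x + h1))
        have c5 := abs_le.1 (hb (x + h2 + h3))
        have c6 := abs_le.1 (hb (x + h2))
        have c7 := abs_le.1 (hb (x + h3))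
        have c8 := abs_le.1 (hb x)
        rw [abs_le]
        constructor <;> linarith [c1.1, c2.1, c3.1, c4.1, c5.1, c6.1, c7.1, c8.1,
          c1.2, c2.2, c3.2, c4.2, c5.2, c6.2, c7.2, c8.2]
      refine h8.trans ?_
      have hrp : 0 < r ^ (2 + δ) := Real.rpow_pos_of_pos hr _
      have : r ^ (2 + δ) ≤ r' ^ (2 + δ) := Real.rpow_le_rpow hr.le hr' (by linarith [hδ.1])
      calc 8 * |M| = B0 * r ^ (2 + δ) := by rw [hB0]; field_simp
        _ ≤ B0 * r' ^ (2 + δ) := mul_le_mul_of_nonneg_left this (by positivity)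
        _ = _ := by ring
    | succ n ih =>
      have := third_step hν hδ hK hE hs hinv hu hF hN1 hr ih
      intro r' hr' h1 h2 h3 v1 v2 v3 n1 n2 n3 t ht x
      refine (this r' hr' h1 h2 h3 v1 v2 v3 n1 n2 n3 t ht x).trans (le_of_eq ?_)
      rw [← hp, ← hγ, ← hD]
      congr 1
      rw [pow_succ]
      linear_combination hTfix
  intro h1 h2 h3 v1 v2 v3 n1 n2 n3 t ht x
  have hl : Tendsto (fun n : ℕ => (T + γ ^ n * (B0 - T)) * r ^ (2 + δ)) atTop
      (nhds ((T + 0 * (B0 - T)) * r ^ (2 + δ))) :=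
    (((tendsto_pow_atTop_nhds_zero_of_lt_one hγ0 hγ1).mul_const _).const_add _).mul_const _
  rw [zero_mul, add_zero] at hl
  exact ge_of_tendsto' hl fun n => hiter n r le_rfl h1 h2 h3 v1 v2 v3 n1 n2 n3 t ht x

end main

lemma mixed_mvt {d : ℕ} {φ : EuclideanSpace ℝ (Fin d) → ℝ} (hφ : ContDiff ℝ 2 φ) (i j : Fin d)
    (x : EuclideanSpace ℝ (Fin d)) {s : ℝ} (hs : 0 < s) :
    ∃ y, dist y x ≤ 2 * s ∧
      φ (x + s • EuclideanSpace.single i 1 + s • EuclideanSpace.single j 1)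
        - φ (x + s • EuclideanSpace.single i 1)
        - (φ (x + s • EuclideanSpace.single j 1) - φ x) = s ^ 2 * sd2 i j φ y := by
  set a : EuclideanSpace ℝ (Fin d) := EuclideanSpace.single i 1 with ha
  set b : EuclideanSpace ℝ (Fin d) := EuclideanSpace.single j 1 with hb
  have hg : ∀ r, HasDerivAt (fun r : ℝ => φ (x + s • a + r • b) - φ (x + r • b))
      (fderiv ℝ φ (x + s • a + r • b) b - fderiv ℝ φ (x + r • b) b) r := fun r =>
    (line_deriv hφ _ _ r).sub (line_deriv hφ _ _ r)
  obtain ⟨ρ, hρ, hρe⟩ := exists_hasDerivAt_eq_slope _ _ hs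
    (fun r _ => (hg r).continuousAt.continuousWithinAt) (fun r _ => hg r)
  have hg2 : ∀ r, HasDerivAt (fun r : ℝ => fderiv ℝ φ (x + ρ • b + r • a) b)
      (fderiv ℝ (fderiv ℝ φ) (x + ρ • b + r • a) a b) r := fun r => line_deriv2 hφ _ _ _ r
  obtain ⟨σ, hσ, hσe⟩ := exists_hasDerivAt_eq_slope _ _ hs
    (fun r _ => (hg2 r).continuousAt.continuousWithinAt) (fun r _ => hg2 r)
  refine ⟨x + ρ • b + σ • a, ?_, ?_⟩
  · rw [dist_eq_norm, show x + ρ • b + σ • a - x = ρ • b + σ • a by abel]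
    refine (norm_add_le _ _).trans ?_
    rw [norm_smul, norm_smul, ha, hb]
    simp only [PiLp.norm_single, norm_one, mul_one, Real.norm_eq_abs]
    rw [abs_of_pos hρ.1, abs_of_pos hσ.1]
    linarith [hρ.2, hσ.2]
  · rw [sd2_eq hφ, ← ha, ← hb, hσe]
    simp only [zero_smul, add_zero, sub_zero] at hρe ⊢
    rw [show x + ρ • b + s • a = x + s • a + ρ • b by abel, hρe]
    field_simp
    ring

lemma dl_double2 {d : ℕ} (u : ℝ → EuclideanSpace ℝ (Fin d) → ℝ)
    (a b k : EuclideanSpace ℝ (Fin d)) (t : ℝ) (x : EuclideanSpace ℝ (Fin d)) :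
    dl (a + a) (dl (b + b) (dl k u)) t x =
      4 * dl a (dl b (dl k u)) t x
      + (dl a (dl a (dl b u)) t (x + k) - dl a (dl a (dl b u)) t x)
      + (dl b (dl a (dl b u)) t (x + k) - dl b (dl a (dl b u)) t x)
      + (dl (a + b) (dl a (dl b u)) t (x + k) - dl (a + b) (dl a (dl b u)) t x) := by
  simp only [dl, ← add_assoc]
  simp only [add_right_comm _ b a, add_right_comm _ k a, add_right_comm _ k b]
  ring

/-- From third differences to Hölder continuity of second derivatives. -/
lemma hess_holder {d q : ℕ} {δ C K : ℝ} (hδ : δ ∈ Ioo (0 : ℝ) 1) (hC : 0 ≤ C * K)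
    {u : ℝ → EuclideanSpace ℝ (Fin d) → ℝ} (hu : Reg u)
    (hD : ∀ r, 0 < r → ∀ h1 h2 h3 : EuclideanSpace ℝ (Fin d), Vx q h1 → Vx q h2 → Vx q h3 →
      ‖h1‖ ≤ r → ‖h2‖ ≤ r → ‖h3‖ ≤ r → ∀ t < 0, ∀ x,
        |dl h1 (dl h2 (dl h3 u)) t x| ≤ C * K * r ^ (2 + δ))
    {i j : Fin d} (hi : (i : ℕ) < q) (hj : (j : ℕ) < q) {k : EuclideanSpace ℝ (Fin d)}
    (hk : Vx q k) (hk0 : k ≠ 0) {t : ℝ} (ht : t < 0) (x : EuclideanSpace ℝ (Fin d)) :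
    |sd2 i j (u t) (x + k) - sd2 i j (u t) x| ≤
      C * K * (1 + 12 / (1 - (1 / 2) ^ δ)) * ‖k‖ ^ δ := by
  set θ : ℝ := (1 / 2) ^ δ with hθ
  have hθ1 : θ < 1 := Real.rpow_lt_one (by norm_num) (by norm_num) hδ.1
  have hθ0 : 0 < θ := by positivity
  have h1θ : 0 < 1 - θ := by linarith
  set r := ‖k‖ with hr
  have hr0 : 0 < r := norm_pos_iff.2 hk0
  set ei : EuclideanSpace ℝ (Fin d) := EuclideanSpace.single i 1 with hei
  set ej : EuclideanSpace ℝ (Fin d) := EuclideanSpace.single j 1 with hej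
  have vi : Vx q ei := fun l hl => by
    have : l ≠ i := fun h => by subst h; omega
    simp [hei, this]
  have vj : Vx q ej := fun l hl => by
    have : l ≠ j := fun h => by subst h; omega
    simp [hej, this]
  have ni : ∀ s : ℝ, 0 ≤ s → ‖s • ei‖ ≤ s := fun s hs => by
    rw [norm_smul, hei]; simp [abs_of_nonneg hs]
  have nj : ∀ s : ℝ, 0 ≤ s → ‖s • ej‖ ≤ s := fun s hs => by
    rw [norm_smul, hej]; simp [abs_of_nonneg hs]
  have hstep : ∀ s : ℝ, 0 < s → |dl (s • ei) (dl (s • ej) (dl k u)) t x| ≤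
      |dl ((2 * s) • ei) (dl ((2 * s) • ej) (dl k u)) t x| / 4 + 12 * (C * K) * (s ^ 2 * s ^ δ) := by
    intro s hs
    have hb : ∀ β, Vx q β → ‖β‖ ≤ 2 * s → ∀ y, |dl β (dl (s • ei) (dl (s • ej) u)) t y| ≤
        8 * (C * K) * (s ^ 2 * s ^ δ) := by
      intro β vβ nβ y
      refine (hD (2 * s) (by linarith) β (s • ei) (s • ej) vβ (vi.smul s) (vj.smul s) nβ
        ((ni s hs.le).trans (by linarith)) ((nj s hs.le).trans (by linarith)) t ht y).trans ?_
      rw [Real.mul_rpow (by norm_num) hs.le, rpow_two_add hs]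
      have h8 : (2 : ℝ) ^ (2 + δ) ≤ 8 := by
        have : (2 : ℝ) ^ (2 + δ) ≤ 2 ^ (3 : ℝ) :=
          Real.rpow_le_rpow_of_exponent_le (by norm_num) (by linarith [hδ.2])
        norm_num at this
        exact this
      have : 0 ≤ s ^ 2 * s ^ δ := by positivity
      have := mul_le_mul_of_nonneg_right h8 this
      nlinarith
    have e2 : ∀ v : EuclideanSpace ℝ (Fin d), (2 * s) • v = s • v + s • v := fun v => by
      rw [two_mul, add_smul]
    rw [e2, e2, dl_double2]
    have nab : ‖s • ei + s • ej‖ ≤ 2 * s := (norm_add_le _ _).trans (by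
      linarith [ni s hs.le, nj s hs.le])
    have na := (ni s hs.le).trans (by linarith : s ≤ 2 * s)
    have nb := (nj s hs.le).trans (by linarith : s ≤ 2 * s)
    have vab := (vi.smul s).add (vj.smul s)
    have b1 := abs_le.1 (hb _ (vi.smul s) na (x + k))
    have b2 := abs_le.1 (hb _ (vi.smul s) na x)
    have b3 := abs_le.1 (hb _ (vj.smul s) nb (x + k))
    have b4 := abs_le.1 (hb _ (vj.smul s) nb x)
    have b5 := abs_le.1 (hb _ vab nab (x + k))
    have b6 := abs_le.1 (hb _ vab nab x)
    generalize hX : 4 * dl (s • ei) (dl (s • ej) (dl k u)) t x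
      + (dl (s • ei) (dl (s • ei) (dl (s • ej) u)) t (x + k)
        - dl (s • ei) (dl (s • ei) (dl (s • ej) u)) t x)
      + (dl (s • ej) (dl (s • ei) (dl (s • ej) u)) t (x + k)
        - dl (s • ej) (dl (s • ei) (dl (s • ej) u)) t x)
      + (dl (s • ei + s • ej) (dl (s • ei) (dl (s • ej) u)) t (x + k)
        - dl (s • ei + s • ej) (dl (s • ei) (dl (s • ej) u)) t x) = X
    rw [abs_le]
    constructor <;> linarith [neg_abs_le X, le_abs_self X, b1.1, b1.2, b2.1, b2.2, b3.1, b3.2,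
      b4.1, b4.2, b5.1, b5.2, b6.1, b6.2]
  have hiter : ∀ n : ℕ, |dl ((r * (1 / 2) ^ n) • ei) (dl ((r * (1 / 2) ^ n) • ej) (dl k u)) t x| ≤
      C * K * r ^ δ * (1 + 12 * ((1 - θ ^ (n + 1)) / (1 - θ))) * (r * (1 / 2) ^ n) ^ 2 := by
    intro n
    induction n with
    | zero =>
      simp only [pow_zero, mul_one, zero_add, pow_one]
      rw [div_self h1θ.ne']
      refine (hD r hr0 _ _ k (vi.smul r) (vj.smul r) hk (ni r hr0.le) (nj r hr0.le) le_rfl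
        t ht x).trans ?_
      rw [rpow_two_add hr0]
      have : 0 ≤ C * K * (r ^ 2 * r ^ δ) := by positivity
      nlinarith
    | succ n ih =>
      have hsp : 0 < r * (1 / 2) ^ (n + 1) := by positivity
      have h := hstep _ hsp
      have e : 2 * (r * (1 / 2) ^ (n + 1)) = r * (1 / 2) ^ n := by rw [pow_succ]; ring
      rw [e] at h
      refine h.trans ?_
      have e3 : (r * (1 / 2) ^ (n + 1)) ^ δ = r ^ δ * θ ^ (n + 1) := by
        rw [Real.mul_rpow hr0.le (by positivity), ← Real.rpow_natCast, ← Real.rpow_mul (by norm_num),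
          mul_comm ((n + 1 : ℕ) : ℝ) δ, Real.rpow_mul (by norm_num), Real.rpow_natCast]
      have e4 : (1 - θ ^ (n + 1 + 1)) / (1 - θ) = (1 - θ ^ (n + 1)) / (1 - θ) + θ ^ (n + 1) := by
        field_simp; ring
      rw [e3, e4]
      calc _ ≤ (C * K * r ^ δ * (1 + 12 * ((1 - θ ^ (n + 1)) / (1 - θ))) * (r * (1 / 2) ^ n) ^ 2) / 4
            + 12 * (C * K) * ((r * (1 / 2) ^ (n + 1)) ^ 2 * (r ^ δ * θ ^ (n + 1))) := by gcongr
        _ = _ := by rw [← e]; ring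
  have hφ : ContDiff ℝ 2 (dl k u t) := (reg_dl hu k).2.1 t ht
  have hcont : Continuous (fun y => sd2 i j (dl k u t) y) := by
    have : (fun y => sd2 i j (dl k u t) y) = fun y => fderiv ℝ (fderiv ℝ (dl k u t)) y ei ej :=
      funext fun y => sd2_eq hφ i j y
    rw [this]
    have h1 : ContDiff ℝ 1 (fderiv ℝ (dl k u t)) := hφ.fderiv_right (by norm_num)
    have h2 : Continuous (fderiv ℝ (fderiv ℝ (dl k u t))) := h1.continuous_fderiv (by norm_num)
    fun_prop
  have hmv : ∀ n : ℕ, ∃ y, dist y x ≤ 2 * (r * (1 / 2) ^ n) ∧ |sd2 i j (dl k u t) y| ≤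
      C * K * (1 + 12 / (1 - θ)) * r ^ δ := by
    intro n
    have hsp : 0 < r * (1 / 2) ^ n := by positivity
    obtain ⟨y, hy1, hy2⟩ := mixed_mvt hφ i j x hsp
    refine ⟨y, hy1, ?_⟩
    have h := hiter n
    have e : dl ((r * (1 / 2) ^ n) • ei) (dl ((r * (1 / 2) ^ n) • ej) (dl k u)) t x
        = (r * (1 / 2) ^ n) ^ 2 * sd2 i j (dl k u t) y := hy2
    rw [e, abs_mul, abs_of_pos (by positivity : 0 < (r * (1 / 2) ^ n) ^ 2), mul_comm] at h
    have h' := le_of_mul_le_mul_right h (by positivity)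
    refine h'.trans ?_
    have : (1 - θ ^ (n + 1)) / (1 - θ) ≤ 1 / (1 - θ) := by
      gcongr
      have : 0 < θ ^ (n + 1) := by positivity
      linarith
    have e5 : 12 / (1 - θ) = 12 * (1 / (1 - θ)) := by ring
    rw [e5]
    calc _ ≤ C * K * r ^ δ * (1 + 12 * (1 / (1 - θ))) := by gcongr
      _ = _ := by ring
  choose y hy1 hy2 using hmv
  have hyx : Tendsto y atTop (nhds x) := by
    rw [tendsto_iff_dist_tendsto_zero]
    refine squeeze_zero (fun _ => dist_nonneg) hy1 ?_
    have := ((tendsto_pow_atTop_nhds_zero_of_lt_one (r := (1 / 2 : ℝ)) (by norm_num)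
      (by norm_num)).const_mul r).const_mul 2
    simpa using this
  have hlim := ((hcont.tendsto x).comp hyx).abs
  have := le_of_tendsto' hlim hy2
  have e : sd2 i j (dl k u t) x = sd2 i j (u t) (x + k) - sd2 i j (u t) x :=
    sd2_diff (hu.2.1 t ht) i j k x
  rwa [e] at this

lemma ell_entry {d : ℕ} {ν : ℝ} (hν : 0 < ν) {A : Matrix (Fin d) (Fin d) ℝ} (hE : Ell d ν A)
    (hs : ∀ i j, A i j = A j i) (i j : Fin d) : A i j ∈ Icc (-ν⁻¹) ν⁻¹ := by
  have hi := ell_diag hE i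
  have hj := ell_diag hE j
  by_cases hij : i = j
  · subst hij
    have : 0 < ν⁻¹ := by positivity
    exact ⟨by linarith, hi.2⟩
  have h := hE (fun k => (if k = i then 1 else 0) + (if k = j then 1 else 0))
  have e1 : ∑ k, ((if k = i then (1:ℝ) else 0) + (if k = j then 1 else 0)) ^ 2 = 2 := by
    have : ∀ k, ((if k = i then (1:ℝ) else 0) + (if k = j then 1 else 0)) ^ 2
        = (if k = i then (1:ℝ) else 0) + (if k = j then 1 else 0) := by
      intro k
      by_cases h1 : k = i
      · have : k ≠ j := fun h => hij (h1.symm.trans h)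
        simp [h1, hij]
      · have hji : ¬ j = i := fun h => hij h.symm
        by_cases h2 : k = j
        · simp [h2, hji]
        · simp [h1, h2]
    simp_rw [this]
    rw [Finset.sum_add_distrib]
    simp
    norm_num
  have e2 : ∑ k, ∑ l, A k l * ((if k = i then (1:ℝ) else 0) + (if k = j then 1 else 0)) *
      ((if l = i then (1:ℝ) else 0) + (if l = j then 1 else 0))
      = A i i + A i j + A j i + A j j := by
    have inner : ∀ k c, ∑ l, A k l * c *
        ((if l = i then (1:ℝ) else 0) + (if l = j then 1 else 0)) = (A k i + A k j) * c := by
      intro k c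
      simp [mul_add, Finset.sum_add_distrib]
      ring
    simp_rw [inner]
    simp [mul_add, Finset.sum_add_distrib]
    ring
  rw [e1, e2, hs j i] at h
  exact ⟨by linarith [h.1], by linarith [h.2]⟩

lemma limit_coeff {d q : ℕ} {ν δ K : ℝ} (hν : 0 < ν) (hδ : 0 < δ)
    {a : Fin d → Fin d → ℝ → EuclideanSpace ℝ (Fin d) → ℝ}
    {u f : ℝ → EuclideanSpace ℝ (Fin d) → ℝ}
    (hsym : ∀ i j t x, a i j t x = a j i t x) (hell : UnifEllipticP d ν a)
    (hinv : ∀ i j (t : ℝ) (x y : EuclideanSpace ℝ (Fin d)),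
          (∀ k : Fin d, q ≤ (k : ℕ) → x k = y k) → a i j t x = a i j t y)
    (hu : ParClassical (parNeg d) u)
    (heq : ∀ᵐ z ∂(volume.restrict (parNeg d)),
          td u z.1 z.2 - ∑ i, ∑ j, a i j z.1 z.2 * sd2 i j (u z.1) z.2 = f z.1 z.2)
    (hf : PHolderXPar d q δ (parNeg d) f K) (t : ℝ) (ht : t < 0)
    (x : EuclideanSpace ℝ (Fin d)) :
    ∃ A : Matrix (Fin d) (Fin d) ℝ, Ell d ν A ∧ (∀ i j, A i j = A j i) ∧
      ∀ h h' : EuclideanSpace ℝ (Fin d), Vx q h → Vx q h' →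
        |(td u t (x + h) - ∑ i, ∑ j, A i j * sd2 i j (u t) (x + h))
          - (td u t (x + h') - ∑ i, ∑ j, A i j * sd2 i j (u t) (x + h'))| ≤ K * ‖h - h'‖ ^ δ := by
  obtain ⟨hu1, hu2, hu3, hu4, hu5, hu6⟩ := hu
  have hopen : IsOpen (parNeg d) := isOpen_Iio.prod isOpen_univ
  rw [ae_restrict_iff' hopen.measurableSet] at heq
  let S : Set (EuclideanSpace ℝ (Fin d)) := {h | Vx q h}
  let D : ℕ → S := fun n => haveI : Nonempty S := ⟨⟨0, fun i _ => by simp⟩⟩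
    TopologicalSpace.denseSeq S n
  have hD : DenseRange D := haveI : Nonempty S := ⟨⟨0, fun i _ => by simp⟩⟩
    TopologicalSpace.denseRange_denseSeq S
  have hgood : ∀ᵐ z : ℝ × EuclideanSpace ℝ (Fin d), ∀ n, z ∈ parNeg d →
      td u z.1 (z.2 + D n) - ∑ i, ∑ j, a i j z.1 (z.2 + D n) * sd2 i j (u z.1) (z.2 + D n)
        = f z.1 (z.2 + D n) := by
    rw [ae_all_iff]
    intro n
    haveI : (volume : Measure (ℝ × EuclideanSpace ℝ (Fin d))).IsAddRightInvariant := by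
      rw [Measure.volume_eq_prod]
      infer_instance
    have hmp := (measurePreserving_add_right (volume : Measure (ℝ × EuclideanSpace ℝ (Fin d)))
      ((0 : ℝ), (D n : EuclideanSpace ℝ (Fin d)))).quasiMeasurePreserving.ae heq
    filter_upwards [hmp] with z hz hzP
    have := hz ⟨by simpa using hzP.1, mem_univ _⟩
    simpa using this
  have hdense := Measure.dense_of_ae hgood
  set G := {z : ℝ × EuclideanSpace ℝ (Fin d) | ∀ n, z ∈ parNeg d →
      td u z.1 (z.2 + D n) - ∑ i, ∑ j, a i j z.1 (z.2 + D n) * sd2 i j (u z.1) (z.2 + D n)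
        = f z.1 (z.2 + D n)} with hGdef
  haveI : (nhdsWithin (t, x) G).NeBot := mem_closure_iff_nhdsWithin_neBot.1 (hdense (t, x))
  let U : Ultrafilter (ℝ × EuclideanSpace ℝ (Fin d)) := Ultrafilter.of (nhdsWithin (t, x) G)
  have hU : (U : Filter _) ≤ nhdsWithin (t, x) G := Ultrafilter.of_le _
  have hUn : (U : Filter _) ≤ nhds (t, x) := hU.trans nhdsWithin_le_nhds
  have hE : ∀ z : ℝ × EuclideanSpace ℝ (Fin d), Ell d ν (fun i j => a i j z.1 z.2) :=
    fun z ξ => hell z.1 z.2 ξ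
  have hcomp : IsCompact (Set.pi univ fun _ : Fin d => Set.pi univ fun _ : Fin d =>
      Icc (-ν⁻¹) ν⁻¹) :=
    isCompact_univ_pi fun _ => isCompact_univ_pi fun _ => isCompact_Icc
  obtain ⟨A, -, hA⟩ := hcomp.ultrafilter_le_nhds
    (U.map fun z => fun i j => a i j z.1 z.2) (by
      rw [le_principal_iff]
      exact Filter.Eventually.of_forall (f := (U : Filter _)) fun z i _ j _ =>
        ell_entry hν (hE z) (fun i j => hsym i j z.1 z.2) i j)
  have hAij : ∀ i j, Tendsto (fun z : ℝ × EuclideanSpace ℝ (Fin d) => a i j z.1 z.2) U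
      (nhds (A i j)) := by
    intro i j
    have h1 : Tendsto (fun z : ℝ × EuclideanSpace ℝ (Fin d) => fun i j => a i j z.1 z.2) U
      (nhds A) := hA
    exact (tendsto_pi_nhds.1 ((tendsto_pi_nhds.1 h1) i)) j
  refine ⟨A, ?_, ?_, ?_⟩
  · intro ξ
    have hl : Tendsto (fun z : ℝ × EuclideanSpace ℝ (Fin d) =>
        ∑ i, ∑ j, a i j z.1 z.2 * ξ i * ξ j) U (nhds (∑ i, ∑ j, A i j * ξ i * ξ j)) :=
      tendsto_finsetSum _ fun i _ => tendsto_finsetSum _ fun j _ =>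
        ((hAij i j).mul_const _).mul_const _
    exact ⟨ge_of_tendsto' hl fun z => (hE z ξ).1, le_of_tendsto' hl fun z => (hE z ξ).2⟩
  · intro i j
    refine tendsto_nhds_unique (hAij i j) ?_
    have : (fun z : ℝ × EuclideanSpace ℝ (Fin d) => a i j z.1 z.2) =
      fun z => a j i z.1 z.2 := funext fun z => hsym i j z.1 z.2
    rw [this]
    exact hAij j i
  have hshift : ∀ (g : ℝ → EuclideanSpace ℝ (Fin d) → ℝ),
      ContinuousOn (fun z : ℝ × EuclideanSpace ℝ (Fin d) => g z.1 z.2) (parNeg d) →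
      ∀ h, Tendsto (fun z : ℝ × EuclideanSpace ℝ (Fin d) => g z.1 (z.2 + h)) U
        (nhds (g t (x + h))) := by
    intro g hg h
    have h1 : ContinuousAt (fun z : ℝ × EuclideanSpace ℝ (Fin d) => g z.1 z.2) (t, x + h) :=
      hg.continuousAt (hopen.mem_nhds ⟨ht, mem_univ _⟩)
    have h2 : Tendsto (fun z : ℝ × EuclideanSpace ℝ (Fin d) => (z.1, z.2 + h)) (nhds (t, x))
        (nhds (t, x + h)) := Continuous.tendsto (by fun_prop) (t, x)
    exact h1.tendsto.comp (h2.mono_left hUn)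
  have hFlim : ∀ h, Tendsto (fun z : ℝ × EuclideanSpace ℝ (Fin d) =>
      td u z.1 (z.2 + h) - ∑ i, ∑ j, a i j z.1 z.2 * sd2 i j (u z.1) (z.2 + h)) U
      (nhds (td u t (x + h) - ∑ i, ∑ j, A i j * sd2 i j (u t) (x + h))) := by
    intro h
    refine (hshift (fun t x => td u t x) hu4 h).sub (tendsto_finsetSum _ fun i _ =>
      tendsto_finsetSum _ fun j _ => (hAij i j).mul ?_)
    exact hshift (fun t x => sd2 i j (u t) x) (hu6 i j) h
  have hdc : ∀ n m, |(td u t (x + D n) - ∑ i, ∑ j, A i j * sd2 i j (u t) (x + D n))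
      - (td u t (x + D m) - ∑ i, ∑ j, A i j * sd2 i j (u t) (x + D m))|
        ≤ K * ‖(D n : EuclideanSpace ℝ (Fin d)) - D m‖ ^ δ := by
    intro n m
    refine le_of_tendsto ((hFlim (D n)).sub (hFlim (D m))).abs ?_
    have hev1 : ∀ᶠ z in (U : Filter (ℝ × EuclideanSpace ℝ (Fin d))), z ∈ parNeg d :=
      hUn (hopen.mem_nhds ⟨ht, mem_univ _⟩)
    have hev2 : ∀ᶠ z in (U : Filter (ℝ × EuclideanSpace ℝ (Fin d))), z ∈ G :=
      hU self_mem_nhdsWithin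
    filter_upwards [hev1, hev2] with z hz1 hz2
    have ea : ∀ n i j, a i j z.1 (z.2 + D n) = a i j z.1 z.2 := fun n i j =>
      hinv i j _ _ _ fun k hk => by
        have := (D n).2 k hk
        simp [this]
    have g1 := hz2 n hz1
    have g2 := hz2 m hz1
    simp only [ea] at g1 g2
    rw [g1, g2]
    have := hf z.1 (z.2 + D n) (z.2 + D m) ⟨hz1.1, mem_univ _⟩ ⟨hz1.1, mem_univ _⟩ (fun k hk => by
      have h1 := (D n).2 k hk
      have h2 := (D m).2 k hk
      simp [h1, h2])
    rwa [dist_eq_norm, add_sub_add_left_eq_sub] at this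
  have hFc : Continuous (fun h : EuclideanSpace ℝ (Fin d) =>
      td u t (x + h) - ∑ i, ∑ j, A i j * sd2 i j (u t) (x + h)) := by
    have hsl : ∀ (g : ℝ → EuclideanSpace ℝ (Fin d) → ℝ),
      ContinuousOn (fun z : ℝ × EuclideanSpace ℝ (Fin d) => g z.1 z.2) (parNeg d) →
      Continuous (fun h => g t (x + h)) := by
      intro g hg
      exact hg.comp_continuous (f := fun h : EuclideanSpace ℝ (Fin d) => (t, x + h))
        (by fun_prop) (fun h => ⟨ht, mem_univ _⟩)
    refine (hsl (fun t x => td u t x) hu4).sub (continuous_finsetSum _ fun i _ =>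
      continuous_finsetSum _ fun j _ => continuous_const.mul ?_)
    exact hsl (fun t x => sd2 i j (u t) x) (hu6 i j)
  intro h h' vh vh'
  have hclosed : IsClosed {p : S × S |
      |(td u t (x + p.1) - ∑ i, ∑ j, A i j * sd2 i j (u t) (x + p.1))
      - (td u t (x + p.2) - ∑ i, ∑ j, A i j * sd2 i j (u t) (x + p.2))|
        ≤ K * ‖(p.1 : EuclideanSpace ℝ (Fin d)) - p.2‖ ^ δ} := by
    refine isClosed_le ?_ ?_
    · exact ((hFc.comp (continuous_subtype_val.comp continuous_fst)).sub
        (hFc.comp (continuous_subtype_val.comp continuous_snd))).abs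
    · refine continuous_const.mul (Continuous.rpow_const (by fun_prop) fun _ => Or.inr hδ.le)
  have hdr : DenseRange (Prod.map D D) := hD.prodMap hD
  have := hdr.induction_on (p := fun p : S × S =>
      |(td u t (x + p.1) - ∑ i, ∑ j, A i j * sd2 i j (u t) (x + p.1))
      - (td u t (x + p.2) - ∑ i, ∑ j, A i j * sd2 i j (u t) (x + p.2))|
        ≤ K * ‖(p.1 : EuclideanSpace ℝ (Fin d)) - p.2‖ ^ δ)
      ((⟨h, vh⟩, ⟨h', vh'⟩) : S × S) hclosed (fun p => hdc p.1 p.2)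
  exact this

/-- Projection killing the `x'` coordinates. -/
def projx {d : ℕ} (q : ℕ) (x : EuclideanSpace ℝ (Fin d)) : EuclideanSpace ℝ (Fin d) :=
  WithLp.toLp 2 fun i => if (i : ℕ) < q then 0 else x i

/-- **Theorem 4.1 (i), first case**: partial Schauder estimate in `x'` on
`(-∞,0) × ℝ^d` for non-divergence form parabolic equations with coefficients
independent of `x'`. -/
theorem partial_schauder_parabolic_wholespace_x
    (d q : ℕ) (ν δ : ℝ) (hd : 2 ≤ d) (hq1 : 1 ≤ q) (hqd : q < d)
    (hν : ν ∈ Ioc (0 : ℝ) 1) (hδ : δ ∈ Ioo (0 : ℝ) 1) :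
    ∃ N : ℝ, 0 < N ∧
      ∀ (a : Fin d → Fin d → ℝ → EuclideanSpace ℝ (Fin d) → ℝ)
        (u f : ℝ → EuclideanSpace ℝ (Fin d) → ℝ),
        (∀ i j, Measurable (fun z : ℝ × EuclideanSpace ℝ (Fin d) => a i j z.1 z.2)) →
        (∀ i j t x, a i j t x = a j i t x) →
        UnifEllipticP d ν a →
        (∀ i j (t : ℝ) (x y : EuclideanSpace ℝ (Fin d)),
          (∀ k : Fin d, q ≤ (k : ℕ) → x k = y k) → a i j t x = a i j t y) →
        ParClassical (parNeg d) u →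
        (∃ M : ℝ, ∀ z ∈ parNeg d, |u z.1 z.2| ≤ M) →
        (∀ᵐ z ∂(volume.restrict (parNeg d)),
          td u z.1 z.2 - ∑ i, ∑ j, a i j z.1 z.2 * sd2 i j (u z.1) z.2 = f z.1 z.2) →
        ∀ K : ℝ, 0 ≤ K → PHolderXPar d q δ (parNeg d) f K →
          ∀ i j : Fin d, (i : ℕ) < q → (j : ℕ) < q →
            PHolderXPar d q δ (parNeg d) (fun t x => sd2 i j (u t) x) (N * K) := by
  have hν0 : 0 < ν := hν.1
  obtain ⟨C, hC0, hC⟩ := third_diff hν0 hδ d q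
  have hθ1 : ((1 : ℝ) / 2) ^ δ < 1 := Real.rpow_lt_one (by norm_num) (by norm_num) hδ.1
  have hθ2 : 0 < 1 - ((1 : ℝ) / 2) ^ δ := by linarith
  refine ⟨C * (1 + 12 / (1 - (1 / 2) ^ δ)), by positivity, ?_⟩
  intro a u f _ hsym hell hinv hu hM heq K hK hf i j hi hj
  have hreg : Reg u := by
    refine ⟨fun t ht x => hu.1 (t, x) ⟨ht, mem_univ _⟩, fun t ht => ?_, hu.2.2.1⟩
    exact contDiff_iff_contDiffAt.2 fun x => hu.2.1 (t, x) ⟨ht, mem_univ _⟩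
  choose! A0 hA1 hA2 hA3 using limit_coeff hν0 hδ.1 hsym hell hinv hu heq hf
  have hproj : ∀ x h : EuclideanSpace ℝ (Fin d), Vx q h → projx q (x + h) = projx q x := by
    intro x h hh
    ext k
    by_cases hk : (k : ℕ) < q
    · simp [projx, hk]
    · simp [projx, hk, hh k (not_lt.1 hk)]
  have hvp : ∀ x : EuclideanSpace ℝ (Fin d), Vx q (x - projx q x) := by
    intro x k hk
    simp [projx, not_lt.2 hk]
  have hthird := hC K hK (fun t x => A0 t (projx q x)) (fun t ht x => hA1 t ht _)
    (fun t ht x => hA2 t ht _) (fun t ht x h hh => by simp only [hproj x h hh]) u hreg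
    (by
      obtain ⟨M, hM⟩ := hM
      exact ⟨M, fun t ht x => hM (t, x) ⟨ht, mem_univ _⟩⟩)
    (by
      intro t ht x h hh
      have := hA3 t ht (projx q x) (x - projx q x + h) (x - projx q x) ((hvp x).add hh) (hvp x)
      simp only [Lop, hproj x h hh]
      rw [← add_assoc, add_sub_cancel, add_sub_cancel_left] at this
      exact this)
  intro t x y hx hy hxy
  by_cases hxe : x = y
  · subst hxe
    simp [Real.zero_rpow hδ.1.ne']
  have hk : Vx q (x - y) := fun k hk => by simp [hxy k hk]
  have := hess_holder hδ (by positivity) hreg hthird hi hj hk (sub_ne_zero.2 hxe) hx.1 y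
  rw [add_sub_cancel, ← dist_eq_norm] at this
  refine this.trans (le_of_eq ?_)
  ring
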